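/- For all α, β ∈ Φ with α + β ∈ Φ, the asymmetry function is antisymmetric: ε(α,β) = −ε(β,α). -/

import Mathlib

noncomputable section

open Finset

attribute [local instance] Classical.propDecidable

/-- Standard inner product on ℝ^N. -/
def inn {N : ℕ} (x y : Fin N → ℝ) : ℝ := ∑ i, x i * y i

/-- Standard basis vector k_i (0-indexed). -/
def kvec {N : ℕ} (i : Fin N) : Fin N → ℝ := fun j => if j = i then 1 else 0

/-- Φ_O : the roots ±k_i ± k_j, i < j (all four sign choices). -/
def PhiO {N : ℕ} : Set (Fin N → ℝ) :=
  {x | ∃ i j : Fin N, i < j ∧ ∃ s t : ℝ, (s = 1 ∨ s = -1) ∧ (t = 1 ∨ t = -1) ∧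
    x = s • kvec i + t • kvec j}

/-- Φ_S : the roots (1/2)(ε_1 k_1 + ⋯ + ε_N k_N), each ε_i = ±1, an even number of ε_i = +1. -/
def PhiS {N : ℕ} : Set (Fin N → ℝ) :=
  {x | ∃ ε : Fin N → ℝ, (∀ i, ε i = 1 ∨ ε i = -1) ∧
    Even ((Finset.univ.filter fun i => ε i = 1).card) ∧
    x = fun i => ε i / 2}

/-- The set of extended roots of e8^(n) (with N = 4(n+1)). -/
def Phi {N : ℕ} : Set (Fin N → ℝ) := PhiO ∪ PhiS

/-- The simple extended roots α_1, …, α_N (0-indexed): for i ≤ N-3 (i.e. α_1,…,α_{N-2}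
1-indexed) it is k_i - k_{i+1}; for i = N-2 (i.e. α_{N-1}) it is k_{N-2} + k_{N-1}
(1-indexed); for i = N-1 (i.e. α_N) it is -(1/2)(k_1 + ⋯ + k_N). -/
def alphaRoot {N : ℕ} (i : Fin N) : Fin N → ℝ :=
  fun j =>
    if (i : ℕ) = N - 1 then -(1/2)
    else if (i : ℕ) = N - 2 then (if (j : ℕ) = N - 3 ∨ (j : ℕ) = N - 2 then 1 else 0)
    else (if (j : ℕ) = (i : ℕ) then 1 else if (j : ℕ) = (i : ℕ) + 1 then -1 else 0)

/-- The lattice element with integer coordinates `c` w.r.t. the simple extended roots. -/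
def toVec {N : ℕ} (c : Fin N → ℤ) : Fin N → ℝ := ∑ i, (c i : ℝ) • alphaRoot i

/-- The asymmetry function on pairs of simple extended roots: ε(α_i,α_i) = -1,
ε(α_i,α_j) = -1 if α_i + α_j is an extended root and α_i < α_j (i.e. i > j in the
ordering α_i > α_{i+1}), and +1 otherwise. -/
def epsSign {N : ℕ} (i j : Fin N) : ℤˣ :=
  if i = j then -1
  else if (alphaRoot i + alphaRoot j) ∈ (Phi : Set (Fin N → ℝ)) ∧ j < i then -1
  else 1

/-- The asymmetry function ε : L × L → {-1,1}, written on integer coordinate vectors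
w.r.t. the basis of simple extended roots:
ε(α,β) = ∏_{i,j} ε(α_i,α_j)^{ℓ_i m_j} for α = ∑ ℓ_i α_i, β = ∑ m_j α_j. -/
def epsFun {N : ℕ} (l m : Fin N → ℤ) : ℤˣ :=
  ∏ i, ∏ j, (epsSign i j) ^ (l i * m j)

lemma inn_comm {N : ℕ} (x y : Fin N → ℝ) : inn x y = inn y x := by
  simp only [inn, mul_comm]

lemma inn_add_left {N : ℕ} (x y z : Fin N → ℝ) : inn (x + y) z = inn x z + inn y z := by
  simp only [inn, Pi.add_apply, add_mul, Finset.sum_add_distrib]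

lemma inn_add_right {N : ℕ} (x y z : Fin N → ℝ) : inn x (y + z) = inn x y + inn x z := by
  simp only [inn, Pi.add_apply, mul_add, Finset.sum_add_distrib]

lemma inn_smul_left {N : ℕ} (c : ℝ) (x y : Fin N → ℝ) : inn (c • x) y = c * inn x y := by
  simp only [inn, Pi.smul_apply, smul_eq_mul, mul_assoc, Finset.mul_sum]

lemma inn_smul_right {N : ℕ} (c : ℝ) (x y : Fin N → ℝ) : inn x (c • y) = c * inn x y := by
  rw [inn_comm, inn_smul_left, inn_comm]

lemma inn_kvec_right {N : ℕ} (x : Fin N → ℝ) (i : Fin N) : inn x (kvec i) = x i := by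
  simp [inn, kvec]

lemma inn_sum_left {N : ℕ} {ι : Type*} (s : Finset ι) (f : ι → Fin N → ℝ) (y : Fin N → ℝ) :
    inn (∑ i ∈ s, f i) y = ∑ i ∈ s, inn (f i) y := by
  simp only [inn, Finset.sum_apply, Finset.sum_mul]
  exact Finset.sum_comm

lemma inn_sum_right {N : ℕ} {ι : Type*} (s : Finset ι) (f : ι → Fin N → ℝ) (x : Fin N → ℝ) :
    inn x (∑ i ∈ s, f i) = ∑ i ∈ s, inn x (f i) := by
  simp only [inn_comm x, inn_sum_left]

lemma inn_add_self {N : ℕ} (x y : Fin N → ℝ) :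
    inn (x + y) (x + y) = inn x x + inn y y + 2 * inn x y := by
  rw [inn_add_left, inn_add_right, inn_add_right, inn_comm y x]
  ring

lemma inn_toVec {N : ℕ} (a b : Fin N → ℤ) :
    inn (toVec a) (toVec b) = ∑ i, ∑ j, (a i : ℝ) * b j * inn (alphaRoot i) (alphaRoot j) := by
  simp only [toVec, inn_sum_left, inn_smul_left]
  simp only [inn_sum_right, inn_smul_right, Finset.mul_sum, mul_assoc]

lemma inn_self_of_mem_PhiO {N : ℕ} {x : Fin N → ℝ} (hx : x ∈ PhiO) : inn x x = 2 := by
  obtain ⟨i, j, hij, s, t, hs, ht, rfl⟩ := hx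
  simp only [inn_add_right, inn_smul_right, inn_kvec_right]
  rcases hs with rfl | rfl <;> rcases ht with rfl | rfl <;>
    norm_num [kvec, hij.ne, hij.ne']

lemma exists_int_of_mem_PhiO {N : ℕ} {x : Fin N → ℝ} (hx : x ∈ PhiO) (k : Fin N) :
    ∃ z : ℤ, x k = z := by
  obtain ⟨i, j, -, s, t, hs, ht, rfl⟩ := hx
  have key : ∀ (r : ℝ), (r = 1 ∨ r = -1) → ∀ l : Fin N, ∃ z : ℤ, r * kvec l k = z := by
    rintro r (rfl | rfl) l
    · exact ⟨if k = l then 1 else 0, by simp [kvec]⟩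
    · exact ⟨-(if k = l then 1 else 0), by simp only [kvec]; split_ifs <;> norm_num⟩
  obtain ⟨z, hz⟩ := key s hs i
  obtain ⟨w, hw⟩ := key t ht j
  exact ⟨z + w, by simp [hz, hw]⟩

lemma ne_intCast_of_half {p : ℝ} (hp : p = 1 / 2 ∨ p = -(1 / 2)) (z : ℤ) : p ≠ z := by
  rintro rfl
  rcases hp with h | h
  · have : (2 * z : ℝ) = 1 := by linarith
    have : 2 * z = 1 := by exact_mod_cast this
    omega
  · have : (2 * z : ℝ) = -1 := by linarith
    have : 2 * z = -1 := by exact_mod_cast this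
    omega

lemma half_of_mem_PhiS {N : ℕ} {x : Fin N → ℝ} (hx : x ∈ PhiS) (k : Fin N) :
    x k = 1 / 2 ∨ x k = -(1 / 2) := by
  obtain ⟨e, he, -, rfl⟩ := hx
  rcases he k with h | h <;> simp only [h] <;> norm_num

lemma inn_self_of_mem_PhiS {N : ℕ} {x : Fin N → ℝ} (hx : x ∈ PhiS) : inn x x = N / 4 := by
  have h : ∀ k, x k * x k = 1 / 4 := fun k => by
    rcases half_of_mem_PhiS hx k with h | h <;> rw [h] <;> norm_num
  simp only [inn, h]
  simp
  ring

lemma inn_of_mem_Phi {n : ℕ} {x y : Fin (4 * (n + 1)) → ℝ} (hx : x ∈ Phi) (hy : y ∈ Phi)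
    (hxy : x + y ∈ Phi) :
    ((x ∈ PhiO ∨ y ∈ PhiO) ∧ inn x y = -1) ∨ (x ∈ PhiS ∧ y ∈ PhiS ∧ inn x y = -n) := by
  have hnorm := inn_add_self x y
  let k : Fin (4 * (n + 1)) := ⟨0, by omega⟩
  have hk : (x + y) k = x k + y k := rfl
  rcases hx with hx | hx <;> rcases hy with hy | hy <;> rcases hxy with hxy | hxy
  · rw [inn_self_of_mem_PhiO hx, inn_self_of_mem_PhiO hy, inn_self_of_mem_PhiO hxy] at hnorm
    exact .inl ⟨.inl hx, by linarith⟩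
  · obtain ⟨z, hz⟩ := exists_int_of_mem_PhiO hx k
    obtain ⟨w, hw⟩ := exists_int_of_mem_PhiO hy k
    exact absurd (by rw [hk, hz, hw]; push_cast; rfl)
      (ne_intCast_of_half (half_of_mem_PhiS hxy k) (z + w))
  · obtain ⟨z, hz⟩ := exists_int_of_mem_PhiO hx k
    obtain ⟨w, hw⟩ := exists_int_of_mem_PhiO hxy k
    exact absurd (by push_cast; linarith)
      (ne_intCast_of_half (half_of_mem_PhiS hy k) (w - z))
  · rw [inn_self_of_mem_PhiO hx, inn_self_of_mem_PhiS hy, inn_self_of_mem_PhiS hxy] at hnorm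
    exact .inl ⟨.inl hx, by linarith⟩
  · obtain ⟨z, hz⟩ := exists_int_of_mem_PhiO hy k
    obtain ⟨w, hw⟩ := exists_int_of_mem_PhiO hxy k
    exact absurd (by push_cast; linarith)
      (ne_intCast_of_half (half_of_mem_PhiS hx k) (w - z))
  · rw [inn_self_of_mem_PhiS hx, inn_self_of_mem_PhiO hy, inn_self_of_mem_PhiS hxy] at hnorm
    exact .inl ⟨.inr hy, by linarith⟩
  · rw [inn_self_of_mem_PhiS hx, inn_self_of_mem_PhiS hy, inn_self_of_mem_PhiO hxy] at hnorm
    push_cast at hnorm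
    exact .inr ⟨hx, hy, by linarith⟩
  · exfalso
    rcases half_of_mem_PhiS hx k with h1 | h1 <;> rcases half_of_mem_PhiS hy k with h2 | h2 <;>
      rcases half_of_mem_PhiS hxy k with h3 | h3 <;> rw [hk, h1, h2] at h3 <;> norm_num at h3

lemma alphaRoot_of_lt {N : ℕ} {i : Fin N} (h : (i : ℕ) + 2 < N) :
    alphaRoot i = (1 : ℝ) • kvec i + (-1 : ℝ) • kvec ⟨i + 1, by omega⟩ := by
  ext j
  have h1 : (i : ℕ) ≠ N - 1 := by omega
  have h2 : (i : ℕ) ≠ N - 2 := by omega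
  simp only [alphaRoot, kvec, h1, h2, if_false, Pi.add_apply, Pi.smul_apply, smul_eq_mul,
    Fin.ext_iff]
  split_ifs <;> first | omega | norm_num

lemma alphaRoot_of_add_two_eq {N : ℕ} (hN : 3 ≤ N) {i : Fin N} (h : (i : ℕ) + 2 = N) :
    alphaRoot i = (1 : ℝ) • kvec ⟨N - 3, by omega⟩ + (1 : ℝ) • kvec i := by
  ext j
  have h1 : (i : ℕ) ≠ N - 1 := by omega
  have h2 : (i : ℕ) = N - 2 := by omega
  have h3 : N - 2 ≠ N - 1 := by omega
  simp only [alphaRoot, kvec, h2, h3, if_true, if_false, Pi.add_apply, Pi.smul_apply, smul_eq_mul,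
    Fin.ext_iff]
  split_ifs <;> first | omega | norm_num

lemma alphaRoot_of_add_one_eq {N : ℕ} {i : Fin N} (h : (i : ℕ) + 1 = N) :
    alphaRoot i = fun _ => -(1 / 2 : ℝ) := by
  ext j
  have h1 : (i : ℕ) = N - 1 := by omega
  simp only [alphaRoot, h1, if_true]

lemma alphaRoot_mem_PhiO {N : ℕ} (hN : 3 ≤ N) {i : Fin N} (h : (i : ℕ) + 1 < N) :
    alphaRoot i ∈ PhiO := by
  by_cases h2 : (i : ℕ) + 2 = N
  · rw [alphaRoot_of_add_two_eq hN h2]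
    exact ⟨_, _, by rw [Fin.lt_def]; simp only; omega, _, _, .inl rfl, .inl rfl, rfl⟩
  · rw [alphaRoot_of_lt (by omega)]
    exact ⟨_, _, by rw [Fin.lt_def]; simp only; omega, _, _, .inl rfl, .inr rfl, rfl⟩

lemma alphaRoot_mem_PhiS {N : ℕ} {i : Fin N} (h : (i : ℕ) + 1 = N) : alphaRoot i ∈ PhiS := by
  rw [alphaRoot_of_add_one_eq h]
  refine ⟨fun _ => -1, fun _ => .inr rfl, ?_, by ext; norm_num⟩
  rw [Finset.filter_false_of_mem (fun _ _ => by norm_num)]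
  simp

lemma alphaRoot_mem_Phi {N : ℕ} (hN : 3 ≤ N) (i : Fin N) : alphaRoot i ∈ Phi := by
  by_cases h : (i : ℕ) + 1 = N
  · exact .inr (alphaRoot_mem_PhiS h)
  · exact .inl (alphaRoot_mem_PhiO hN (by omega))

lemma inn_alphaRoot_of_lt {N : ℕ} (hN : 4 ≤ N) {i j : Fin N} (hij : i < j) :
    (inn (alphaRoot j) (alphaRoot i) = -1 ∧ alphaRoot j + alphaRoot i ∈ Phi) ∨
      inn (alphaRoot j) (alphaRoot i) = 0 := by
  rw [Fin.lt_def] at hij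
  by_cases hj1 : (j : ℕ) + 1 = N
  · rw [alphaRoot_of_add_one_eq hj1]
    by_cases hi2 : (i : ℕ) + 2 = N
    · left
      rw [alphaRoot_of_add_two_eq (by omega) hi2]
      simp only [inn_add_right, inn_smul_right, inn_kvec_right]
      refine ⟨by norm_num, .inr ?_⟩
      have hne : (⟨N - 3, by omega⟩ : Fin N) ≠ i := by rw [Ne, Fin.ext_iff]; simp only; omega
      refine ⟨fun k => if k = ⟨N - 3, by omega⟩ ∨ k = i then 1 else -1, fun k => ?_, ?_, ?_⟩
      · simp only; split_ifs <;> simp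
      · have : (Finset.univ.filter fun k : Fin N =>
            (if k = ⟨N - 3, by omega⟩ ∨ k = i then (1 : ℝ) else -1) = 1)
            = {⟨N - 3, by omega⟩, i} := by
          ext k
          simp only [Finset.mem_filter, Finset.mem_univ, true_and, Finset.mem_insert,
            Finset.mem_singleton]
          split_ifs with h
          · simp [h]
          · simp only [h, iff_false]; norm_num
        rw [this, Finset.card_pair hne]
        exact even_two
      · ext k
        simp only [Pi.add_apply, Pi.smul_apply, smul_eq_mul, kvec]
        by_cases h1 : k = ⟨N - 3, by omega⟩
        · have h2 : k ≠ i := h1 ▸ hne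
          simp only [h1, hne, if_true, if_false, true_or]; norm_num
        · by_cases h2 : k = i <;>
            simp only [h1, h2, hne.symm, if_true, if_false, or_true, or_false] <;> norm_num
    · right
      rw [alphaRoot_of_lt (i := i) (by omega)]
      simp only [inn_add_right, inn_smul_right, inn_kvec_right]
      norm_num
  · rw [alphaRoot_of_lt (i := i) (by omega)]
    by_cases hj2 : (j : ℕ) + 2 = N
    · rw [alphaRoot_of_add_two_eq (by omega) hj2]
      simp only [inn_add_right, inn_smul_right, inn_kvec_right]
      by_cases h : (i : ℕ) + 4 = N
      · left
        constructor
        · simp only [Pi.add_apply, Pi.smul_apply, smul_eq_mul, kvec, Fin.ext_iff]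
          split_ifs <;> first | omega | norm_num
        · refine .inl ⟨i, j, hij, 1, 1, .inl rfl, .inl rfl, ?_⟩
          ext k
          simp only [Pi.add_apply, Pi.smul_apply, smul_eq_mul, kvec, Fin.ext_iff]
          split_ifs <;> first | omega | norm_num
      · right
        simp only [Pi.add_apply, Pi.smul_apply, smul_eq_mul, kvec, Fin.ext_iff]
        split_ifs <;> first | omega | norm_num
    · rw [alphaRoot_of_lt (i := j) (by omega)]
      simp only [inn_add_right, inn_smul_right, inn_kvec_right]
      by_cases h : (i : ℕ) + 1 = j
      · left
        constructor
        · simp only [Pi.add_apply, Pi.smul_apply, smul_eq_mul, kvec, Fin.ext_iff]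
          split_ifs <;> first | omega | norm_num
        · refine .inl ⟨i, ⟨j + 1, by omega⟩, by rw [Fin.lt_def]; simp only; omega, 1, -1,
            .inl rfl, .inr rfl, ?_⟩
          ext k
          simp only [Pi.add_apply, Pi.smul_apply, smul_eq_mul, kvec, Fin.ext_iff]
          split_ifs <;> first | omega | norm_num
      · right
        simp only [Pi.add_apply, Pi.smul_apply, smul_eq_mul, kvec, Fin.ext_iff]
        split_ifs <;> first | omega | norm_num

lemma epsSign_mul_epsSign_of_lt {n : ℕ} {i j : Fin (4 * (n + 1))} (hij : i < j) :
    ∃ c : ℤ, (c : ℝ) = inn (alphaRoot j) (alphaRoot i) ∧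
      epsSign i j * epsSign j i = (-1) ^ c := by
  have h1 : epsSign i j = 1 := by simp [epsSign, hij.ne, hij.not_gt]
  rcases inn_alphaRoot_of_lt (by omega) hij with ⟨h, hm⟩ | h
  · exact ⟨-1, by rw [h]; norm_num, by rw [h1]; simp [epsSign, hij.ne', hij, hm]⟩
  · refine ⟨0, by rw [h]; norm_num, ?_⟩
    have hm : alphaRoot j + alphaRoot i ∉ Phi := by
      intro hm
      have hi : alphaRoot i ∈ PhiO := alphaRoot_mem_PhiO (by omega) (by
        have := j.isLt; rw [Fin.lt_def] at hij; omega)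
      rcases inn_of_mem_Phi (alphaRoot_mem_Phi (by omega) j) (alphaRoot_mem_Phi (by omega) i) hm
        with ⟨-, h'⟩ | ⟨-, hS, -⟩
      · rw [h] at h'; norm_num at h'
      · obtain ⟨z, hz⟩ := exists_int_of_mem_PhiO hi i
        exact ne_intCast_of_half (half_of_mem_PhiS hS i) z hz
    rw [h1]
    simp [epsSign, hij.ne', hm]

/-- The index of the last simple extended root, the only one lying in Φ_S. -/
def lastIdx (n : ℕ) : Fin (4 * (n + 1)) := ⟨4 * n + 3, by omega⟩

lemma zpow_sum_eq_prod {G ι : Type*} [CommGroup G] (g : G) (s : Finset ι) (f : ι → ℤ) :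
    g ^ (∑ i ∈ s, f i) = ∏ i ∈ s, g ^ f i := by
  induction s using Finset.induction_on with
  | empty => simp
  | insert i s hi ih => rw [Finset.sum_insert hi, Finset.prod_insert hi, zpow_add, ih]

lemma epsSign_mul_epsSign {n : ℕ} (i j : Fin (4 * (n + 1))) :
    ∃ c : ℤ, (c : ℝ) = inn (alphaRoot i) (alphaRoot j) -
        (if i = lastIdx n ∧ j = lastIdx n then (n + 1 : ℝ) else 0) ∧
      epsSign i j * epsSign j i = (-1) ^ c := by
  rcases lt_trichotomy i j with h | rfl | h
  · obtain ⟨c, hc, hs⟩ := epsSign_mul_epsSign_of_lt h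
    refine ⟨c, ?_, hs⟩
    rw [if_neg (fun h' => h.ne (h'.1.trans h'.2.symm)), hc, inn_comm, sub_zero]
  · have hs : epsSign i i * epsSign i i = 1 := by simp [epsSign]
    by_cases hi : i = lastIdx n
    · refine ⟨0, ?_, by simp [hs]⟩
      rw [inn_self_of_mem_PhiS (alphaRoot_mem_PhiS (by rw [hi]; simp only [lastIdx]; omega)),
        if_pos ⟨hi, hi⟩]
      push_cast
      ring
    · refine ⟨2, ?_, by rw [hs]; rfl⟩
      rw [inn_self_of_mem_PhiO (alphaRoot_mem_PhiO (by omega) ?_), if_neg (fun h => hi h.1)]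
      · norm_num
      · have := i.isLt
        have : (i : ℕ) ≠ lastIdx n := fun h => hi (Fin.ext h)
        simp only [lastIdx] at this
        omega
  · obtain ⟨c, hc, hs⟩ := epsSign_mul_epsSign_of_lt h
    refine ⟨c, ?_, by rw [mul_comm, hs]⟩
    rw [if_neg (fun h' => h.ne (h'.2.trans h'.1.symm)), hc, sub_zero]

lemma epsFun_mul_epsFun {n : ℕ} (a b : Fin (4 * (n + 1)) → ℤ) :
    ∃ c : ℤ, (c : ℝ) = inn (toVec a) (toVec b) - (n + 1) * a (lastIdx n) * b (lastIdx n) ∧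
      epsFun a b * epsFun b a = (-1) ^ c := by
  choose c hc hs using epsSign_mul_epsSign (n := n)
  refine ⟨∑ i, ∑ j, c i j * (a i * b j), ?_, ?_⟩
  · push_cast
    simp only [hc, sub_mul, Finset.sum_sub_distrib, inn_toVec]
    congr 1
    · exact Finset.sum_congr rfl fun i _ => Finset.sum_congr rfl fun j _ => by ring
    · rw [Finset.sum_eq_single (lastIdx n), Finset.sum_eq_single (lastIdx n)]
      · simp; ring
      · intro j _ hj; simp [hj]
      · simp
      · intro i _ hi; simp [hi]
      · simp
  · have hswap : epsFun b a = ∏ i, ∏ j, epsSign j i ^ (a i * b j) := by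
      rw [epsFun, Finset.prod_comm]
      simp only [mul_comm]
    rw [hswap, epsFun]
    simp only [zpow_sum_eq_prod, ← Finset.prod_mul_distrib, ← mul_zpow, hs, ← zpow_mul]

lemma toVec_last {n : ℕ} (a : Fin (4 * (n + 1)) → ℤ) :
    toVec a (lastIdx n) = -(a (lastIdx n) / 2 : ℝ) := by
  rw [toVec, Finset.sum_apply, Finset.sum_eq_single (lastIdx n)]
  · rw [alphaRoot_of_add_one_eq (by simp only [lastIdx]; omega)]
    simp only [Pi.smul_apply, smul_eq_mul]
    ring
  · intro i _ hi
    have h1 := i.isLt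
    have h2 : (i : ℕ) ≠ lastIdx n := fun h => hi (Fin.ext h)
    simp only [lastIdx] at h2
    by_cases h : (i : ℕ) + 2 = 4 * (n + 1)
    · rw [alphaRoot_of_add_two_eq (by omega) h]
      simp only [Pi.add_apply, Pi.smul_apply, smul_eq_mul, kvec, Fin.ext_iff, lastIdx]
      split_ifs <;> first | omega | norm_num
    · rw [alphaRoot_of_lt (by omega)]
      simp only [Pi.add_apply, Pi.smul_apply, smul_eq_mul, kvec, Fin.ext_iff, lastIdx]
      split_ifs <;> first | omega | norm_num
  · simp

lemma even_last_of_toVec_mem_PhiO {n : ℕ} {a : Fin (4 * (n + 1)) → ℤ} (ha : toVec a ∈ PhiO) :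
    Even (a (lastIdx n)) := by
  obtain ⟨z, hz⟩ := exists_int_of_mem_PhiO ha (lastIdx n)
  rw [toVec_last] at hz
  have : (a (lastIdx n) : ℝ) = (-z : ℤ) + (-z : ℤ) := by push_cast; linarith
  exact ⟨-z, by exact_mod_cast this⟩

lemma odd_last_of_toVec_mem_PhiS {n : ℕ} {a : Fin (4 * (n + 1)) → ℤ} (ha : toVec a ∈ PhiS) :
    Odd (a (lastIdx n)) := by
  have h := half_of_mem_PhiS ha (lastIdx n)
  rw [toVec_last] at h
  rcases h with h | h
  · have : (a (lastIdx n) : ℝ) = (-1 : ℤ) := by push_cast; linarith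
    rw [show a (lastIdx n) = -1 by exact_mod_cast this]
    decide
  · have : (a (lastIdx n) : ℝ) = (1 : ℤ) := by push_cast; linarith
    rw [show a (lastIdx n) = 1 by exact_mod_cast this]
    decide

/-- For α, β ∈ Φ with α + β ∈ Φ, the asymmetry function is antisymmetric:
ε(α,β) = -ε(β,α). -/
theorem stmt16 (n : ℕ) (hn : 1 ≤ n) (a b : Fin (4*(n+1)) → ℤ)
    (ha : toVec a ∈ (Phi : Set (Fin (4*(n+1)) → ℝ)))
    (hb : toVec b ∈ (Phi : Set (Fin (4*(n+1)) → ℝ)))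
    (hab : toVec a + toVec b ∈ (Phi : Set (Fin (4*(n+1)) → ℝ))) :
    epsFun a b = - epsFun b a := by
  obtain ⟨c, hc, hs⟩ := epsFun_mul_epsFun a b
  have hodd : Odd c := by
    rcases inn_of_mem_Phi ha hb hab with ⟨hO, h⟩ | ⟨haS, hbS, h⟩
    · have hc' : c = -1 - (n + 1) * (a (lastIdx n) * b (lastIdx n)) := by
        rw [h, mul_assoc] at hc
        exact_mod_cast hc
      have he : Even (a (lastIdx n) * b (lastIdx n)) :=
        hO.elim (fun h => (even_last_of_toVec_mem_PhiO h).mul_right _)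
          (fun h => (even_last_of_toVec_mem_PhiO h).mul_left _)
      rw [hc']
      exact Odd.sub_even (by decide) (he.mul_left _)
    · have hc' : c = -n - (n + 1) * (a (lastIdx n) * b (lastIdx n)) := by
        rw [h, mul_assoc] at hc
        exact_mod_cast hc
      obtain ⟨k, hk⟩ := (odd_last_of_toVec_mem_PhiS haS).mul (odd_last_of_toVec_mem_PhiS hbS)
      rw [hc', hk]
      exact ⟨-n - 1 - (n + 1) * k, by ring⟩
  rw [hodd.neg_one_zpow] at hs
  rcases Int.units_eq_one_or (epsFun a b) with h1 | h1 <;>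
    rcases Int.units_eq_one_or (epsFun b a) with h2 | h2 <;> rw [h1, h2] at hs ⊢ <;> revert hs <;>
    decide
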